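/- arXiv:2311.00099 — 4 statements merged into one kernel-verified Lean document; each statement's English description precedes it below -/
import Mathlib

section
/- Let W ∈ ℚ^{m×n}, w ∈ ℚ^m, p ∈ {0,1,…,n}, and set 𝒜 := {x ∈ ℝ^n : Wx = w} and 𝒮 := 𝒜 ∩ (ℤ^p × ℝ^{n−p}). Write W = [A B] where A consists of the first p columns of W and B of the last n−p columns, and define n' := n − rank(W) and p' := p − rank(W) + rank(B). If 𝒮 is nonempty, then there exist a vector x̄ ∈ ℤ^p × ℚ^{n−p} and a matrix M ∈ ℚ^{n×n'} of rank n' such that, with τ(x') := x̄ + Mx', one has 𝒜 = τ(ℝ^{n'}) and 𝒮 = τ(ℤ^{p'} × ℝ^{n'−p'}). -/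
open Matrix

/-- The set of vectors in `ℝ^n` whose first `p` coordinates are integers,
i.e. `ℤ^p × ℝ^(n-p)`. -/
def mixedIntSet (n p : ℕ) : Set (Fin n → ℝ) :=
  {x | ∀ i : Fin n, (i : ℕ) < p → ∃ z : ℤ, x i = (z : ℝ)}

/-- A subspace of `ℚ^ι` has a basis that generates its lattice of integral points. -/
lemma exists_basis_integral_iff {ι : Type*} [Fintype ι] (V : Submodule ℚ (ι → ℚ)) (r : ℕ)
    (hr : Module.finrank ℚ V = r) :
    ∃ b : Module.Basis (Fin r) ℚ V, ∀ v : V,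
      (∀ i, ∃ z : ℤ, (v : ι → ℚ) i = z) ↔ ∀ j, ∃ z : ℤ, b.repr v j = z := by
  classical
  let c : (ι → ℤ) →ₗ[ℤ] (ι → ℚ) := (algebraMap ℤ ℚ).toIntAlgHom.toLinearMap.compLeft ι
  have hc : ∀ x i, c x i = (x i : ℚ) := fun x i => rfl
  let L : Submodule ℤ (ι → ℤ) := (V.restrictScalars ℤ).comap c
  let f : L →ₗ[ℤ] V := (c.comp L.subtype).codRestrict (V.restrictScalars ℤ) (fun x => x.2)
  have hf : ∀ x i, (f x : ι → ℚ) i = ((x : ι → ℤ) i : ℚ) := fun x i => rfl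
  have hfinj : LinearMap.ker f = ⊥ := by
    rw [LinearMap.ker_eq_bot]
    intro x y hxy
    ext i
    have := hf x i
    rw [hxy, hf] at this
    exact_mod_cast this.symm
  have hlift : ∀ v : V, (∀ i, ∃ z : ℤ, (v : ι → ℚ) i = z) → ∃ l, f l = v := by
    intro v hv
    choose z hz using hv
    have hcz : c z = v := by ext i; rw [hc, hz]
    refine ⟨⟨z, ?_⟩, Subtype.ext hcz⟩
    change c z ∈ V
    rw [hcz]
    exact v.2
  let b := Module.finBasis ℤ L
  have hli : LinearIndependent ℚ (f ∘ b) :=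
    (LinearIndependent.iff_fractionRing ℤ ℚ).1 (b.linearIndependent.map' f hfinj)
  have hsum : ∀ l, f l = ∑ j, ((b.repr l j : ℤ) : ℚ) • (f ∘ b) j := by
    intro l
    conv_lhs => rw [← b.sum_repr l, map_sum]
    refine Finset.sum_congr rfl fun j _ => ?_
    rw [map_smul]
    exact (Int.cast_smul_eq_zsmul ℚ _ _).symm
  have hspan : ⊤ ≤ Submodule.span ℚ (Set.range (f ∘ b)) := by
    intro v _
    obtain ⟨d, hd⟩ := IsLocalization.exist_integer_multiples_of_finite
      (nonZeroDivisors ℤ) (v : ι → ℚ)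
    have hd0 : ((d : ℤ) : ℚ) ≠ 0 := by exact_mod_cast nonZeroDivisors.coe_ne_zero d
    obtain ⟨l, hl⟩ := hlift (((d : ℤ) : ℚ) • v) (by
      intro i
      obtain ⟨z, hz⟩ := hd i
      exact ⟨z, by simpa using hz.symm⟩)
    rw [← inv_smul_smul₀ hd0 v, ← hl, hsum]
    exact Submodule.smul_mem _ _ (Submodule.sum_mem _ fun j _ =>
      Submodule.smul_mem _ _ (Submodule.subset_span ⟨j, rfl⟩))
  let B := Module.Basis.mk hli hspan
  have hcard : Module.finrank ℤ L = r := by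
    rw [← hr, Module.finrank_eq_card_basis B, Fintype.card_fin]
  refine ⟨B.reindex (finCongr hcard), fun v => ⟨fun hv j => ?_, fun hv i => ?_⟩⟩
  · obtain ⟨l, rfl⟩ := hlift v hv
    refine ⟨b.repr l ((finCongr hcard).symm j), ?_⟩
    have : f l = ∑ j, ((b.repr l j : ℤ) : ℚ) • B j := by
      rw [hsum]; simp [B]
    rw [this, Module.Basis.repr_reindex_apply, Module.Basis.repr_sum_self]
  · choose z hz using hv
    refine ⟨∑ j, z j * (b ((finCongr hcard).symm j) : ι → ℤ) i, ?_⟩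
    conv_lhs => rw [← (B.reindex (finCongr hcard)).sum_repr v]
    simp only [hz]
    simp [B, hf, Finset.sum_apply]

/-- A finite-dimensional rational space with a linear map `π` to `ℚ^ι` has a basis in which
`π x` is integral exactly when the first `rank π` coordinates of `x` are. -/
lemma exists_basis_map_integral_iff {ι E : Type*} [Fintype ι] [AddCommGroup E] [Module ℚ E]
    [FiniteDimensional ℚ E] (π : E →ₗ[ℚ] (ι → ℚ)) (n' p' : ℕ)
    (hn' : Module.finrank ℚ E = n') (hp' : Module.finrank ℚ (LinearMap.range π) = p') :
    ∃ b : Module.Basis (Fin n') ℚ E, ∀ x,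
      (∀ i, ∃ z : ℤ, π x i = z) ↔ ∀ j : Fin n', (j : ℕ) < p' → ∃ z : ℤ, b.repr x j = z := by
  obtain ⟨v, hv⟩ := exists_basis_integral_iff (LinearMap.range π) p' hp'
  obtain ⟨s, hs⟩ := π.rangeRestrict.exists_rightInverse_of_surjective π.range_rangeRestrict
  have hdim := π.finrank_range_add_finrank_ker
  let k := Module.finBasis ℚ (LinearMap.ker π)
  have hsv : ∀ y, π.rangeRestrict (s y) = y := fun y => LinearMap.congr_fun hs y
  have hker : ∀ x, (LinearMap.id - s.comp π.rangeRestrict : E →ₗ[ℚ] E) x ∈ LinearMap.ker π := by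
    intro x
    have h := congrArg Subtype.val (hsv (π.rangeRestrict x))
    rw [LinearMap.mem_ker, LinearMap.sub_apply, map_sub, sub_eq_zero]
    exact h.symm
  have hk : ∀ x : LinearMap.ker π, π.rangeRestrict x = 0 := fun x => Subtype.ext x.2
  let e : E ≃ₗ[ℚ] LinearMap.range π × LinearMap.ker π :=
    LinearEquiv.ofLinearMap
      (π.rangeRestrict.prod ((LinearMap.id - s.comp π.rangeRestrict).codRestrict _ hker))
      (s.coprod (LinearMap.ker π).subtype)
      (LinearMap.ext fun y => by
        refine Prod.ext ?_ (Subtype.ext ?_) <;> simp [hsv, hk])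
      (LinearMap.ext fun x => by simp)
  let σ : Fin p' ⊕ Fin (Module.finrank ℚ (LinearMap.ker π)) ≃ Fin n' :=
    finSumFinEquiv.trans (finCongr (by omega))
  refine ⟨((v.prod k).map e.symm).reindex σ, fun x => ?_⟩
  refine (hv (π.rangeRestrict x)).trans ?_
  constructor
  · intro h j hj
    have : σ.symm j = Sum.inl ⟨j, hj⟩ := by
      rw [Equiv.symm_apply_eq]; ext; simp [σ]
    simpa [this, e] using h ⟨j, hj⟩
  · intro h j
    have := h (σ (Sum.inl j)) (by simp [σ])
    simpa [e] using this

/-- Rational matrices commute with the coordinatewise action of rational functionals on `ℝ`. -/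
lemma mulVec_functional {κ μ : Type*} [Fintype κ] (M : Matrix μ κ ℚ) (g : ℝ →ₗ[ℚ] ℚ)
    (x : κ → ℝ) : g ∘ (M.map ((↑) : ℚ → ℝ) *ᵥ x) = M *ᵥ (g ∘ x) := by
  ext i
  simp only [Function.comp_apply, Matrix.mulVec, dotProduct, Matrix.map_apply, map_sum]
  refine Finset.sum_congr rfl fun j _ => ?_
  rw [← Rat.smul_def, map_smul, smul_eq_mul]

/-- Rational functionals separate real vectors. -/
lemma eq_zero_of_functionals {κ : Type*} (x : κ → ℝ)
    (h : ∀ g : ℝ →ₗ[ℚ] ℚ, g ∘ x = 0) : x = 0 := by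
  ext i
  exact (Module.forall_dual_apply_eq_zero_iff ℚ (x i)).1 fun g => congrFun (h g) i

lemma exists_rat_retraction : ∃ f : ℝ →ₗ[ℚ] ℚ, ∀ q : ℚ, f q = q := by
  obtain ⟨f, hf⟩ := (Algebra.linearMap ℚ ℝ).exists_leftInverse_of_injective
    (LinearMap.ker_eq_bot.2 (algebraMap ℚ ℝ).injective)
  exact ⟨f, fun q => LinearMap.congr_fun hf q⟩

/-- The restriction of the kernel of `W` to a block of coordinates has dimension determined by
the ranks of `W` and of its complementary block of columns. -/
lemma finrank_range_restrict_ker_add_rank {μ κ κ₁ κ₂ : Type*} [Fintype κ] [Fintype κ₁]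
    [Fintype κ₂] (W : Matrix μ κ ℚ) (e : κ₁ ⊕ κ₂ ≃ κ) :
    Module.finrank ℚ (LinearMap.range ((LinearMap.funLeft ℚ ℚ (e ∘ Sum.inl)).domRestrict
      (LinearMap.ker W.mulVecLin))) + W.rank =
      Fintype.card κ₁ + (W.submatrix id (e ∘ Sum.inr)).rank := by
  set B := W.submatrix id (e ∘ Sum.inr) with hB
  set π := (LinearMap.funLeft ℚ ℚ (e ∘ Sum.inl)).domRestrict (LinearMap.ker W.mulVecLin)
  have hmul : ∀ x : κ → ℚ, (∀ i, x (e (Sum.inl i)) = 0) → W *ᵥ x = B *ᵥ (x ∘ e ∘ Sum.inr) := by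
    intro x hx
    ext i
    simp [Matrix.mulVec, dotProduct, ← e.sum_comp, hx, hB]
  have hπ0 : ∀ x : LinearMap.ker π, ∀ i, (x : κ → ℚ) (e (Sum.inl i)) = 0 :=
    fun x i => congrFun x.2 i
  have hker : ∀ x : LinearMap.ker π,
      (LinearMap.funLeft ℚ ℚ (e ∘ Sum.inr)) (x : κ → ℚ) ∈ LinearMap.ker B.mulVecLin := by
    intro x
    exact (hmul x (hπ0 x)).symm.trans x.1.2
  let r : LinearMap.ker π →ₗ[ℚ] LinearMap.ker B.mulVecLin :=
    ((LinearMap.funLeft ℚ ℚ (e ∘ Sum.inr)).comp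
      ((Submodule.subtype _).comp (Submodule.subtype _))).codRestrict _ hker
  have hr : Function.Bijective r := by
    constructor
    · intro x y hxy
      ext i
      obtain ⟨i | i, rfl⟩ := e.surjective i
      · exact (hπ0 x i).trans (hπ0 y i).symm
      · exact congrFun (congrArg Subtype.val hxy) i
    · intro y
      let x : κ → ℚ := Sum.elim 0 (y : κ₂ → ℚ) ∘ e.symm
      have hx : ∀ i, x (e (Sum.inl i)) = 0 := by simp [x]
      have hxy : x ∘ e ∘ Sum.inr = y := by ext; simp [x]
      refine ⟨⟨⟨x, ?_⟩, funext hx⟩, Subtype.ext hxy⟩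
      refine (hmul x hx).trans ?_
      rw [hxy]
      exact y.2
  have h1 := (LinearEquiv.ofBijective r hr).finrank_eq
  have h2 := π.finrank_range_add_finrank_ker
  have h3 := W.mulVecLin.finrank_range_add_finrank_ker
  have h4 := B.mulVecLin.finrank_range_add_finrank_ker
  have h5 := Fintype.card_congr e
  rw [Fintype.card_sum] at h5
  rw [Module.finrank_fintype_fun_eq_card] at h3 h4
  change W.rank + _ = _ at h3
  change B.rank + _ = _ at h4
  omega

/-- A rational matrix parametrizing the rational kernel of `W`, compatibly with integrality. -/
lemma exists_kernel_matrix {m n p n' p' : ℕ} (W : Matrix (Fin m) (Fin n) ℚ) (hp : p ≤ n)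
    (hn' : n' = n - W.rank)
    (hp' : p' = p + (W.submatrix id
      (fun j : Fin (n - p) => (⟨p + (j : ℕ), by have := j.isLt; omega⟩ : Fin n))).rank - W.rank) :
    ∃ M : Matrix (Fin n) (Fin n') ℚ, Function.Injective M.mulVecLin ∧
      (∀ x, W *ᵥ x = 0 ↔ ∃ q, M *ᵥ q = x) ∧
      ∀ q, (∀ i : Fin n, (i : ℕ) < p → ∃ z : ℤ, (M *ᵥ q) i = z) ↔
        ∀ j : Fin n', (j : ℕ) < p' → ∃ z : ℤ, q j = z := by
  let e : Fin p ⊕ Fin (n - p) ≃ Fin n := finSumFinEquiv.trans (finCongr (by omega))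
  have hrange := finrank_range_restrict_ker_add_rank W e
  have he : e ∘ Sum.inr =
      fun j : Fin (n - p) => (⟨p + (j : ℕ), by have := j.isLt; omega⟩ : Fin n) := by
    ext j; simp [e]
  rw [he, Fintype.card_fin] at hrange
  have hK := W.mulVecLin.finrank_range_add_finrank_ker
  rw [Module.finrank_fintype_fun_eq_card, Fintype.card_fin] at hK
  change W.rank + _ = _ at hK
  obtain ⟨b, hb⟩ := exists_basis_map_integral_iff
    ((LinearMap.funLeft ℚ ℚ (e ∘ Sum.inl)).domRestrict (LinearMap.ker W.mulVecLin)) n' p'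
    (by omega) (by omega)
  let M : Matrix (Fin n) (Fin n') ℚ := Matrix.of fun i j => (b j : Fin n → ℚ) i
  have hM : ∀ q, M *ᵥ q = b.equivFun.symm q := by
    intro q
    ext i
    simp [M, Matrix.mulVec, dotProduct, Module.Basis.equivFun_symm_apply, mul_comm]
  refine ⟨M, fun q q' h => ?_, fun x => ⟨fun hx => ?_, ?_⟩, fun q => ?_⟩
  · refine b.equivFun.symm.injective (Subtype.ext ?_)
    rw [← hM, ← hM]
    exact h
  · exact ⟨b.equivFun ⟨x, hx⟩, by rw [hM, LinearEquiv.symm_apply_apply]⟩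
  · rintro ⟨q, rfl⟩
    rw [hM]
    exact (b.equivFun.symm q).2
  · have h := hb (b.equivFun.symm q)
    have hr : ∀ j, b.repr (b.equivFun.symm q) j = q j := fun j => by
      rw [← Module.Basis.equivFun_apply, LinearEquiv.apply_symm_apply]
    simp only [hr] at h
    rw [← h, hM]
    constructor
    · intro H i
      exact H (e (Sum.inl i)) (by simp [e])
    · intro H i hi
      have hei : e (Sum.inl ⟨i, hi⟩) = i := by ext; simp [e]
      simpa [hei] using H ⟨i, hi⟩

lemma mulVec_ratCast {κ μ : Type*} [Fintype κ] (M : Matrix μ κ ℚ) (q : κ → ℚ) :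
    M.map ((↑) : ℚ → ℝ) *ᵥ (fun j => (q j : ℝ)) = fun i => ((M *ᵥ q) i : ℝ) := by
  ext i
  simp [Matrix.mulVec, dotProduct]

/-- A rational matrix `M` parametrizing the rational kernel of `W` also parametrizes the real one. -/
lemma real_kernel_iff {μ κ ν : Type*} [Fintype κ] [Fintype ν]
    (W : Matrix μ κ ℚ) (M : Matrix κ ν ℚ)
    (hinj : Function.Injective M.mulVecLin) (hker : ∀ x, W *ᵥ x = 0 ↔ ∃ q, M *ᵥ q = x)
    (y : κ → ℝ) :
    W.map ((↑) : ℚ → ℝ) *ᵥ y = 0 ↔ ∃ x, M.map ((↑) : ℚ → ℝ) *ᵥ x = y := by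
  classical
  constructor
  · intro hy
    obtain ⟨N, hN⟩ := M.mulVecLin.exists_leftInverse_of_injective (LinearMap.ker_eq_bot.2 hinj)
    have hNM : ∀ q, N.toMatrix' *ᵥ (M *ᵥ q) = q := fun q => by
      rw [← Matrix.toLin'_apply, Matrix.toLin'_toMatrix']
      exact LinearMap.congr_fun hN q
    refine ⟨N.toMatrix'.map ((↑) : ℚ → ℝ) *ᵥ y, sub_eq_zero.1 (eq_zero_of_functionals _ ?_)⟩
    intro g
    have hg : W *ᵥ (g ∘ y) = 0 := by
      rw [← mulVec_functional, hy]
      ext; simp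
    obtain ⟨q, hq⟩ := (hker _).1 hg
    have h := mulVec_functional M g (N.toMatrix'.map ((↑) : ℚ → ℝ) *ᵥ y)
    rw [mulVec_functional N.toMatrix', ← hq, hNM, hq] at h
    ext i
    simpa [sub_eq_zero] using congrFun h i
  · rintro ⟨x, rfl⟩
    refine eq_zero_of_functionals _ fun g => ?_
    rw [mulVec_functional, mulVec_functional]
    exact (hker _).2 ⟨_, rfl⟩

lemma eq_zero_of_forall_mul_integral (t : ℚ) (h : ∀ c : ℚ, ∃ z : ℤ, c * t = z) : t = 0 := by
  by_contra ht
  obtain ⟨z, hz⟩ := h (1 / (2 * t))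
  have h1 : (2 * z : ℚ) = 1 := by
    rw [← hz]; field_simp
  have h2 : 2 * z = 1 := by exact_mod_cast h1
  omega

/-- If `M` detects integrality of rational vectors, in the coordinates selected by `P` and `Q`,
then it also detects integrality of real vectors. -/
lemma real_integral_iff {κ ν : Type*} [Fintype ν] (M : Matrix κ ν ℚ) (P : κ → Prop)
    (Q : ν → Prop)
    (h : ∀ q, (∀ i, P i → ∃ z : ℤ, (M *ᵥ q) i = z) ↔ ∀ j, Q j → ∃ z : ℤ, q j = z)
    (y : ν → ℝ) :
    (∀ i, P i → ∃ z : ℤ, (M.map ((↑) : ℚ → ℝ) *ᵥ y) i = z) ↔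
      ∀ j, Q j → ∃ z : ℤ, y j = z := by
  have hzero : ∀ q, (∀ i, P i → (M *ᵥ q) i = 0) ↔ ∀ j, Q j → q j = 0 := by
    intro q
    constructor
    · intro H j hj
      refine eq_zero_of_forall_mul_integral _ fun c => (h (c • q)).1 (fun i hi => ⟨0, ?_⟩) j hj
      simp [Matrix.mulVec_smul, H i hi]
    · intro H i hi
      refine eq_zero_of_forall_mul_integral _ fun c => ?_
      obtain ⟨z, hz⟩ := (h (c • q)).2 (fun j hj => ⟨0, by simp [H j hj]⟩) i hi
      exact ⟨z, by simpa [Matrix.mulVec_smul] using hz⟩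
  have hsep : ∀ t : ℝ, t = 0 ↔ ∀ g : ℝ →ₗ[ℚ] ℚ, g t = 0 :=
    fun t => (Module.forall_dual_apply_eq_zero_iff ℚ t).symm
  have hzeroR : ∀ u : ν → ℝ, (∀ i, P i → (M.map ((↑) : ℚ → ℝ) *ᵥ u) i = 0) ↔
      ∀ j, Q j → u j = 0 := by
    intro u
    have hg := fun g : ℝ →ₗ[ℚ] ℚ => hzero (g ∘ u)
    simp only [← mulVec_functional, Function.comp_apply] at hg
    simp only [hsep]
    exact ⟨fun H j hj g => (hg g).1 (fun i hi => H i hi g) j hj,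
      fun H i hi g => (hg g).2 (fun j hj => H j hj g) i hi⟩
  obtain ⟨f, hf⟩ := exists_rat_retraction
  have hint : ∀ t : ℝ, (∃ z : ℤ, t = z) ↔ (∃ z : ℤ, f t = z) ∧ t - (f t : ℝ) = 0 := by
    intro t
    constructor
    · rintro ⟨z, rfl⟩
      have hz : f (z : ℝ) = z := by simpa using hf z
      exact ⟨⟨z, hz⟩, by rw [hz]; simp⟩
    · rintro ⟨⟨z, hz⟩, ht⟩
      exact ⟨z, by rw [sub_eq_zero.1 ht, hz]; simp⟩
  have h1 := h (f ∘ y)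
  have h2 := hzeroR (y - fun j => ((f ∘ y) j : ℝ))
  rw [Matrix.mulVec_sub, mulVec_ratCast] at h2
  simp only [← mulVec_functional, Pi.sub_apply, Function.comp_apply] at h1 h2
  simp only [hint, forall_and, h1, h2]

/-- A mixed-integer real solution of a rational system yields a mixed-integer rational one. -/
lemma exists_rational_solution {μ κ : Type*} [Fintype κ] (W : Matrix μ κ ℚ) (w : μ → ℚ)
    (P : κ → Prop) (x : κ → ℝ) (hx : W.map ((↑) : ℚ → ℝ) *ᵥ x = fun i => (w i : ℝ))
    (hP : ∀ i, P i → ∃ z : ℤ, x i = z) :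
    ∃ q : κ → ℚ, W *ᵥ q = w ∧ ∀ i, P i → ∃ z : ℤ, q i = z := by
  obtain ⟨f, hf⟩ := exists_rat_retraction
  refine ⟨f ∘ x, ?_, fun i hi => ?_⟩
  · rw [← mulVec_functional, hx]
    ext i
    exact hf _
  · obtain ⟨z, hz⟩ := hP i hi
    exact ⟨z, by simpa [hz] using hf z⟩

/-- Characterization of mixed integer solutions to a system of linear
equations: if `𝒮 = {x : Wx = w} ∩ (ℤ^p × ℝ^(n-p))` is nonempty, there is an affine map
`τ(x') = x̄ + Mx'`, with `x̄ ∈ ℤ^p × ℚ^(n-p)` and `M` a rational `n × n'` matrix of full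
column rank, mapping `ℝ^(n')` onto `𝒜` and `ℤ^(p') × ℝ^(n'-p')` onto `𝒮`, where
`n' = n - rank W` and `p' = p - rank W + rank B`. -/
theorem mixed_integer_solutions_linear_system
    (m n : ℕ) (W : Matrix (Fin m) (Fin n) ℚ) (w : Fin m → ℚ)
    (p : ℕ) (hp : p ≤ n)
    (A : Set (Fin n → ℝ))
    (hA : A = {x | (W.map ((↑) : ℚ → ℝ)) *ᵥ x = fun i => (w i : ℝ)})
    (S : Set (Fin n → ℝ)) (hS : S = A ∩ mixedIntSet n p)
    (B : Matrix (Fin m) (Fin (n - p)) ℚ)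
    (hB : B = W.submatrix id (fun j : Fin (n - p) => (⟨p + (j : ℕ), by have := j.isLt; omega⟩ : Fin n)))
    (n' p' : ℕ) (hn' : n' = n - W.rank) (hp' : p' = p + B.rank - W.rank)
    (hne : S.Nonempty) :
    ∃ (xb : Fin n → ℚ) (M : Matrix (Fin n) (Fin n') ℚ),
      (∀ i : Fin n, (i : ℕ) < p → ∃ z : ℤ, xb i = (z : ℚ)) ∧
      M.rank = n' ∧
      A = (fun x' : Fin n' → ℝ =>
            (fun i => (xb i : ℝ)) + (M.map ((↑) : ℚ → ℝ)) *ᵥ x') '' Set.univ ∧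
      S = (fun x' : Fin n' → ℝ =>
            (fun i => (xb i : ℝ)) + (M.map ((↑) : ℚ → ℝ)) *ᵥ x') '' mixedIntSet n' p' := by
  subst hB
  obtain ⟨x₀, hx₀⟩ := hne
  rw [hS, hA] at hx₀
  obtain ⟨xb, hxb, hxbint⟩ := exists_rational_solution W w (fun i => (i : ℕ) < p) x₀ hx₀.1 hx₀.2
  obtain ⟨M, hinj, hker, hint⟩ := exists_kernel_matrix W hp hn' hp'
  have hW : W.map ((↑) : ℚ → ℝ) *ᵥ (fun i => (xb i : ℝ)) = fun i => (w i : ℝ) := by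
    rw [mulVec_ratCast, hxb]
  have hmem : ∀ x, x ∈ A ↔
      ∃ x', (fun i => (xb i : ℝ)) + (M.map ((↑) : ℚ → ℝ)) *ᵥ x' = x := by
    intro x
    have h := real_kernel_iff W M hinj hker (x - fun i => (xb i : ℝ))
    rw [Matrix.mulVec_sub, hW, sub_eq_zero] at h
    rw [hA, Set.mem_ofPred_eq, h]
    simp only [eq_sub_iff_add_eq']
  have hmixed : ∀ x', (fun i => (xb i : ℝ)) + (M.map ((↑) : ℚ → ℝ)) *ᵥ x' ∈ mixedIntSet n p ↔
      x' ∈ mixedIntSet n' p' := by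
    intro x'
    refine Iff.trans ?_ (real_integral_iff M (fun i => (i : ℕ) < p) (fun j => (j : ℕ) < p') hint x')
    refine forall_congr' fun i => imp_congr_right fun hi => ?_
    obtain ⟨z, hz⟩ := hxbint i hi
    rw [Pi.add_apply, hz]
    constructor
    · rintro ⟨t, ht⟩
      exact ⟨t - z, by push_cast at ht ⊢; linarith⟩
    · rintro ⟨t, ht⟩
      exact ⟨z + t, by push_cast; linarith⟩
  refine ⟨xb, M, hxbint, ?_, ?_, ?_⟩
  · exact (LinearMap.finrank_range_of_inj hinj).trans (by simp)
  · ext x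
    simp [hmem]
  · ext x
    rw [hS, Set.mem_inter_iff, hmem]
    constructor
    · rintro ⟨⟨x', rfl⟩, hx⟩
      exact ⟨x', (hmixed x').1 hx, rfl⟩
    · rintro ⟨x', hx', rfl⟩
      exact ⟨⟨x', rfl⟩, (hmixed x').2 hx'⟩
end

section
/- Let W ∈ ℚ^{m×n}, w ∈ ℚ^m, p ∈ {0,1,…,n}, and set 𝒜 := {x ∈ ℝ^n : Wx = w} and 𝒮 := 𝒜 ∩ (ℤ^p × ℝ^{n−p}). Write W = [A B] where A consists of the first p columns of W and B of the last n−p columns, and define p' := p − rank(W) + rank(B). Assume 𝒮 is nonempty and that there exist d ∈ ℚ^n with d ≠ 0 and d_{p+1} = ⋯ = d_n = 0, and β ∈ ℚ, such that dᵀx = β for every x ∈ 𝒜. Then rank(B) ≤ rank(W) − 1, and hence p' ≤ p − 1. -/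
open Matrix

/-- If the linear functional `d ≠ 0` vanishes on the kernel of `W` and on the columns of `E`,
then `W * E` has smaller rank than `W`. -/
theorem rank_mul_lt_rank_of_vecMul_eq_zero {K l m n : Type*} [Field K] [Fintype l] [Fintype m]
    [Fintype n] (W : Matrix l m K) (E : Matrix m n K) {d : m → K} (hd : d ≠ 0)
    (hE : d ᵥ* E = 0) (hker : ∀ v, W *ᵥ v = 0 → d ⬝ᵥ v = 0) :
    (W * E).rank < W.rank := by
  classical
  refine lt_of_le_of_ne (rank_mul_le_left W E) fun h => hd ?_
  have hle : LinearMap.range (W * E).mulVecLin ≤ LinearMap.range W.mulVecLin := by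
    rw [mulVecLin_mul]
    exact LinearMap.range_comp_le_range _ _
  have heq := Submodule.eq_of_le_of_finrank_eq hle h
  ext i
  have hmem : W *ᵥ Pi.single i 1 ∈ LinearMap.range (W * E).mulVecLin :=
    heq ▸ ⟨Pi.single i 1, rfl⟩
  obtain ⟨u, hu⟩ := hmem
  rw [mulVecLin_apply, ← mulVec_mulVec] at hu
  have hv := hker (Pi.single i 1 - E *ᵥ u) (by rw [mulVec_sub, hu, sub_self])
  simpa [dotProduct_sub, dotProduct_mulVec, hE] using hv

/-- A linear equation valid on a nonempty real solution set of a rational system vanishes on the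
rational kernel of the system. -/
theorem dotProduct_eq_zero_of_forall_solution {m n : Type*} [Fintype n] (W : Matrix m n ℚ)
    {b : m → ℝ} {d : n → ℚ} {β : ℝ} {x : n → ℝ} (hx : W.map ((↑) : ℚ → ℝ) *ᵥ x = b)
    (hvalid : ∀ y : n → ℝ, W.map ((↑) : ℚ → ℝ) *ᵥ y = b → ∑ i, (d i : ℝ) * y i = β)
    {v : n → ℚ} (hv : W *ᵥ v = 0) : d ⬝ᵥ v = 0 := by
  have hv' : W.map ((↑) : ℚ → ℝ) *ᵥ (fun i => (v i : ℝ)) = 0 := by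
    ext i
    have h := congrFun hv i
    simp only [mulVec, dotProduct, map_apply, Pi.zero_apply] at h ⊢
    exact_mod_cast h
  have h₁ := hvalid (x + fun i => (v i : ℝ)) (by rw [mulVec_add, hx, hv', add_zero])
  have h₂ := hvalid x hx
  simp only [Pi.add_apply, mul_add, Finset.sum_add_distrib, h₂, add_eq_left] at h₁
  simp only [dotProduct]
  exact_mod_cast h₁

/-- If `𝒮 = {x : Wx = w} ∩ (ℤ^p × ℝ^(n-p))` is nonempty and some
equality `dᵀx = β`, with `d ≠ 0` supported on the first `p` coordinates, is valid for
`𝒜 = {x : Wx = w}`, then `rank B ≤ rank W - 1` and hence `p' ≤ p - 1`, where `B`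
consists of the last `n - p` columns of `W` and `p' = p - rank W + rank B`. -/
theorem rank_drop_of_valid_integer_equation
    (m n : ℕ) (W : Matrix (Fin m) (Fin n) ℚ) (w : Fin m → ℚ)
    (p : ℕ) (hp : p ≤ n)
    (A : Set (Fin n → ℝ))
    (hA : A = {x | (W.map ((↑) : ℚ → ℝ)) *ᵥ x = fun i => (w i : ℝ)})
    (S : Set (Fin n → ℝ)) (hS : S = A ∩ mixedIntSet n p)
    (B : Matrix (Fin m) (Fin (n - p)) ℚ)
    (hB : B = W.submatrix id (fun j : Fin (n - p) =>
      (⟨p + (j : ℕ), by have := j.isLt; omega⟩ : Fin n)))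
    (p' : ℕ) (hp' : p' = p + B.rank - W.rank)
    (hne : S.Nonempty)
    (d : Fin n → ℚ) (hd0 : d ≠ 0) (hdsupp : ∀ i : Fin n, p ≤ (i : ℕ) → d i = 0)
    (β : ℚ) (hvalid : ∀ x ∈ A, ∑ i, (d i : ℝ) * x i = (β : ℝ)) :
    B.rank + 1 ≤ W.rank ∧ p' + 1 ≤ p := by
  subst hA hS
  obtain ⟨x, hx, -⟩ := hne
  have hlt : B.rank < W.rank := by
    let f : Fin (n - p) → Fin n := fun j => ⟨p + (j : ℕ), by have := j.isLt; omega⟩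
    have hBE : B = W * (1 : Matrix (Fin n) (Fin n) ℚ).submatrix id f := by
      rw [hB]
      ext i j
      simp [mul_apply, one_apply, f]
    rw [hBE]
    refine rank_mul_lt_rank_of_vecMul_eq_zero W _ hd0 ?_
      fun v hv => dotProduct_eq_zero_of_forall_solution W hx hvalid hv
    ext j
    simpa [vecMul, dotProduct, one_apply] using hdsupp (f j) (Nat.le_add_right p j)
  have hp0 : p ≠ 0 := by
    rintro rfl
    exact hd0 (funext fun i => hdsupp i (Nat.zero_le _))
  omega
end

section
/- Let 𝒬 = {x ∈ ℝ^n : Wx ≤ w, xᵀHx + hᵀx ≤ η} be a convex quadratic set, let 𝒫 := {x ∈ ℝ^n : Wx ≤ w}, and let q(x) := xᵀHx + hᵀx. Assume 𝒫 is full-dimensional, that η is the minimum of q over 𝒫 (i.e., there exists x ∈ 𝒫 with q(x) = η and q(x) ≥ η for all x ∈ 𝒫), and that inf{q(x) : x ∈ ℝ^n} < η (i.e., there exists x ∈ ℝ^n with q(x) < η). Then 𝒬 is nonempty, 𝒬 has empty interior, and there exist c ∈ ℝ^n with c ≠ 0 and δ ∈ ℝ such that cᵀx ≥ δ for all x ∈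 𝒫, 𝒬 ⊆ {x ∈ 𝒫 : cᵀx = δ}, and cᵀx > δ for some x ∈ 𝒫 (so 𝒬 is contained in a proper face of 𝒫). -/
open Matrix

/-- Second-order expansion of a quadratic polynomial with symmetric matrix `A`. -/
theorem quadratic_add_smul {n : ℕ} {A : Matrix (Fin n) (Fin n) ℝ} (hA : A.IsSymm)
    (b x d : Fin n → ℝ) (t : ℝ) :
    (x + t • d) ⬝ᵥ (A *ᵥ (x + t • d)) + b ⬝ᵥ (x + t • d) =
      (x ⬝ᵥ (A *ᵥ x) + b ⬝ᵥ x) + t * (((2 : ℝ) • (A *ᵥ x) + b) ⬝ᵥ d) +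
        t ^ 2 * (d ⬝ᵥ (A *ᵥ d)) := by
  have hsymm : x ⬝ᵥ (A *ᵥ d) = d ⬝ᵥ (A *ᵥ x) := by
    rw [dotProduct_mulVec, ← mulVec_transpose, hA.eq, dotProduct_comm]
  have hcomm : (A *ᵥ x) ⬝ᵥ d = d ⬝ᵥ (A *ᵥ x) := dotProduct_comm _ _
  simp only [mulVec_add, mulVec_smul, add_dotProduct, dotProduct_add, smul_dotProduct,
    dotProduct_smul, smul_eq_mul, hsymm, hcomm]
  ring

/-- A real number `a` with `0 ≤ t * a + t ^ 2 * b` for all `t ∈ (0, 1]` is nonnegative. -/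
theorem nonneg_of_forall_mul_add_sq_mul_nonneg {a b : ℝ} (hb : 0 ≤ b)
    (hab : ∀ t : ℝ, 0 < t → t ≤ 1 → 0 ≤ t * a + t ^ 2 * b) : 0 ≤ a := by
  by_contra! ha
  have hpos : 0 < b - a := by linarith
  have ht : 0 < -a / (b - a) := div_pos (by linarith) hpos
  have hval := hab _ ht ((div_le_one hpos).2 (by linarith))
  have hmul : -a / (b - a) * (b - a) = -a := div_mul_cancel₀ _ hpos.ne'
  nlinarith [mul_pos ht ht]

/-- A nonzero linear form increases strictly from any interior point of a set within the set. -/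
theorem exists_mem_dotProduct_gt_of_mem_interior {n : ℕ} {S : Set (Fin n → ℝ)}
    {c y : Fin n → ℝ} (hc : c ≠ 0) (hy : y ∈ interior S) : ∃ z ∈ S, c ⬝ᵥ y < c ⬝ᵥ z := by
  have hcont : Filter.Tendsto (fun t : ℝ => y + t • c) (nhdsWithin 0 (Set.Ioi 0)) (nhds y) := by
    have hcts : Continuous fun t : ℝ => y + t • c := by fun_prop
    have hlim := hcts.tendsto 0
    rw [zero_smul, add_zero] at hlim
    exact hlim.mono_left nhdsWithin_le_nhds
  obtain ⟨t, htS, ht⟩ :=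
    ((hcont.eventually (mem_interior_iff_mem_nhds.1 hy)).and self_mem_nhdsWithin).exists
  have hcc : 0 < c ⬝ᵥ c :=
    lt_of_le_of_ne (Finset.sum_nonneg fun i _ => mul_self_nonneg (c i))
      fun h0 => hc (dotProduct_self_eq_zero.1 h0.symm)
  refine ⟨y + t • c, htS, ?_⟩
  rw [dotProduct_add, dotProduct_smul, smul_eq_mul]
  exact lt_add_of_pos_right _ (mul_pos ht hcc)

/-- A polyhedron `{x | A x ≤ b}` is convex. -/
theorem convex_setOf_mulVec_le {m n : ℕ} (A : Matrix (Fin m) (Fin n) ℝ) (b : Fin m → ℝ) :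
    Convex ℝ {x | A *ᵥ x ≤ b} :=
  (convex_Iic b).linear_preimage A.mulVecLin

/-- Let `𝒬 = {x : Wx ≤ w, q(x) ≤ η}` be a convex quadratic set with
`𝒫 = {x : Wx ≤ w}` full-dimensional, suppose `η` is the minimum of `q(x) = xᵀHx + hᵀx`
over `𝒫` while `inf_{ℝ^n} q < η`. Then `𝒬` is nonempty, has empty interior, and `𝒬`
is contained in a proper face of `𝒫`: there are `c ≠ 0` and `δ` with `cᵀx ≥ δ` on `𝒫`,
`𝒬 ⊆ {x ∈ 𝒫 : cᵀx = δ}`, and `cᵀx > δ` for some `x ∈ 𝒫`. -/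
theorem cqs_min_on_polyhedron_contained_in_proper_face
    (m n : ℕ) (W : Matrix (Fin m) (Fin n) ℚ) (w : Fin m → ℚ)
    (H : Matrix (Fin n) (Fin n) ℚ) (h : Fin n → ℚ) (η : ℚ)
    (hsym : H.IsSymm)
    (hpsd : ∀ x : Fin n → ℝ, 0 ≤ x ⬝ᵥ ((H.map ((↑) : ℚ → ℝ)) *ᵥ x))
    (q : (Fin n → ℝ) → ℝ)
    (hq : q = fun x => x ⬝ᵥ ((H.map ((↑) : ℚ → ℝ)) *ᵥ x) + (fun i => (h i : ℝ)) ⬝ᵥ x)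
    (P : Set (Fin n → ℝ))
    (hP : P = {x | (W.map ((↑) : ℚ → ℝ)) *ᵥ x ≤ fun i => (w i : ℝ)})
    (Q : Set (Fin n → ℝ)) (hQ : Q = {x ∈ P | q x ≤ (η : ℝ)})
    (hPfull : (interior P).Nonempty)
    (hminP : (∃ x ∈ P, q x = (η : ℝ)) ∧ ∀ x ∈ P, (η : ℝ) ≤ q x)
    (hinf : ∃ x : Fin n → ℝ, q x < (η : ℝ)) :
    Q.Nonempty ∧ interior Q = ∅ ∧
    ∃ c : Fin n → ℝ, c ≠ 0 ∧ ∃ δ : ℝ,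
      (∀ x ∈ P, δ ≤ c ⬝ᵥ x) ∧
      Q ⊆ {x ∈ P | c ⬝ᵥ x = δ} ∧
      ∃ x ∈ P, δ < c ⬝ᵥ x := by
  have hA : (H.map ((↑) : ℚ → ℝ)).IsSymm := hsym.map _
  have hPconv : Convex ℝ P := hP ▸ convex_setOf_mulVec_le _ _
  obtain ⟨⟨x₀, hx₀, hqx₀⟩, hmin⟩ := hminP
  obtain ⟨y, hy⟩ := hPfull
  obtain ⟨z, hz⟩ := hinf
  set A := H.map ((↑) : ℚ → ℝ)
  set c : Fin n → ℝ := (2 : ℝ) • (A *ᵥ x₀) + fun i => (h i : ℝ)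
  have hexp (x : Fin n → ℝ) (t : ℝ) : q (x₀ + t • (x - x₀)) =
      η + t * (c ⬝ᵥ (x - x₀)) + t ^ 2 * ((x - x₀) ⬝ᵥ (A *ᵥ (x - x₀))) := by
    rw [← hqx₀, hq]
    exact quadratic_add_smul hA _ _ _ _
  have hgrad (x : Fin n → ℝ) : η + c ⬝ᵥ (x - x₀) ≤ q x := by
    have hx := hexp x 1
    rw [one_smul, add_sub_cancel] at hx
    linarith [hpsd (x - x₀)]
  have hc : c ≠ 0 := by
    intro h0
    have := hgrad z
    rw [h0, zero_dotProduct] at this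
    linarith
  have hface (x) (hx : x ∈ P) : c ⬝ᵥ x₀ ≤ c ⬝ᵥ x := by
    rw [← sub_nonneg, ← dotProduct_sub]
    refine nonneg_of_forall_mul_add_sq_mul_nonneg (hpsd (x - x₀)) fun t ht ht1 => ?_
    have := hmin _ (hPconv.add_smul_sub_mem hx₀ hx ⟨ht.le, ht1⟩)
    rw [hexp] at this
    linarith
  have hQface : Q ⊆ {x ∈ P | c ⬝ᵥ x = c ⬝ᵥ x₀} := by
    rw [hQ]
    rintro x ⟨hx, hqx⟩
    have := hgrad x
    rw [dotProduct_sub] at this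
    exact ⟨hx, le_antisymm (by linarith) (hface x hx)⟩
  refine ⟨⟨x₀, hQ ▸ ⟨hx₀, hqx₀.le⟩⟩, ?_, c, hc, c ⬝ᵥ x₀, hface, hQface, ?_⟩
  · refine Set.eq_empty_of_forall_notMem fun u hu => ?_
    obtain ⟨v, hv, huv⟩ := exists_mem_dotProduct_gt_of_mem_interior hc hu
    exact huv.ne ((hQface (interior_subset hu)).2.trans (hQface hv).2.symm)
  · obtain ⟨v, hv, hyv⟩ := exists_mem_dotProduct_gt_of_mem_interior hc hy
    exact ⟨v, hv, (hface y (interior_subset hy)).trans_lt hyv⟩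
end

section
/- Let 𝒬 = {x ∈ ℝ^n : Wx ≤ w, xᵀHx + hᵀx ≤ η} be a convex quadratic set with (H, h) ≠ (0, 0), let 𝒫 := {x ∈ ℝ^n : Wx ≤ w}, and let q(x) := xᵀHx + hᵀx. Then 𝒬 is full-dimensional if and only if 𝒫 is full-dimensional and there exists x ∈ 𝒫 with q(x) < η. -/
open Matrix

/-- A quadratic function `xᵀAx + hᵀx` with `A` symmetric that is constant on a nonempty open set
is identically zero. -/
theorem quadratic_eq_zero_of_eqOn_open {n : ℕ} {A : Matrix (Fin n) (Fin n) ℝ} (hA : A.IsSymm)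
    {h : Fin n → ℝ} {c : ℝ} {U : Set (Fin n → ℝ)} (hU : IsOpen U) (hne : U.Nonempty)
    (hc : ∀ x ∈ U, x ⬝ᵥ (A *ᵥ x) + h ⬝ᵥ x = c) : A = 0 ∧ h = 0 := by
  obtain ⟨y, hy⟩ := hne
  have key : ∀ d : Fin n → ℝ,
      d ⬝ᵥ (A *ᵥ d) = 0 ∧ d ⬝ᵥ (A *ᵥ y) + y ⬝ᵥ (A *ᵥ d) + h ⬝ᵥ d = 0 := by
    intro d
    have hline : IsOpen {t : ℝ | y + t • d ∈ U ∧ y + (-t) • d ∈ U} :=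
      (hU.preimage (by fun_prop : Continuous fun t : ℝ => y + t • d)).inter
        (hU.preimage (by fun_prop : Continuous fun t : ℝ => y + (-t) • d))
    obtain ⟨ε, hε, hball⟩ := Metric.isOpen_iff.1 hline 0 (by simp [hy])
    have hhalf : ε / 2 ∈ Metric.ball (0 : ℝ) ε := by
      rw [Metric.mem_ball, Real.dist_eq, sub_zero, abs_of_pos (half_pos hε)]
      exact half_lt_self hε
    have hpos : 0 < ε / 2 := half_pos hε
    obtain ⟨hplus, hminus⟩ := hball hhalf
    generalize ε / 2 = t at *
    have h0 := hc y hy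
    have h1 := hc _ hplus
    have h2 := hc _ hminus
    simp only [mulVec_add, mulVec_smul, dotProduct_add, add_dotProduct, smul_dotProduct,
      dotProduct_smul, smul_eq_mul] at h1 h2
    constructor
    · have : t ^ 2 * (d ⬝ᵥ (A *ᵥ d)) = 0 := by linear_combination (h1 + h2) / 2 - h0
      simpa [hpos.ne'] using this
    · have : t * (d ⬝ᵥ (A *ᵥ y) + y ⬝ᵥ (A *ᵥ d) + h ⬝ᵥ d) = 0 := by
        linear_combination (h1 - h2) / 2
      simpa [hpos.ne'] using this
  have polar : ∀ d e : Fin n → ℝ, d ⬝ᵥ (A *ᵥ e) + e ⬝ᵥ (A *ᵥ d) = 0 := by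
    intro d e
    have hde := (key (d + e)).1
    simp only [mulVec_add, dotProduct_add, add_dotProduct] at hde
    linarith [(key d).1, (key e).1]
  constructor
  · ext i j
    have hij := polar (Pi.single i 1) (Pi.single j 1)
    simp only [mulVec_single_one, single_one_dotProduct, col_apply] at hij
    rw [hA.apply i j] at hij
    simpa using hij
  · ext i
    have hi := (key (Pi.single i 1)).2
    rw [polar, zero_add, dotProduct_single_one] at hi
    exact hi

/-- If a convex set with nonempty interior meets the open set `{f < c}`, then so does its
interior. -/
theorem Convex.exists_mem_interior_lt {E : Type*} [AddCommGroup E] [Module ℝ E]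
    [TopologicalSpace E] [IsTopologicalAddGroup E] [ContinuousSMul ℝ E]
    {s : Set E} (hs : Convex ℝ s) (hne : (interior s).Nonempty)
    {f : E → ℝ} (hf : Continuous f) {c : ℝ} {x : E} (hx : x ∈ s) (hfx : f x < c) :
    ∃ y ∈ interior s, f y < c := by
  have hcl : x ∈ closure (interior s) := by
    rw [hs.closure_interior_eq_closure_of_nonempty_interior hne]
    exact subset_closure hx
  obtain ⟨y, hy, hyi⟩ := mem_closure_iff.1 hcl _ (isOpen_lt hf continuous_const) hfx
  exact ⟨y, hyi, hy⟩

/-- Characterization of full-dimensional convex quadratic sets: for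
`𝒬 = {x : Wx ≤ w, q(x) ≤ η}` with `(H, h) ≠ (0, 0)` and `q(x) = xᵀHx + hᵀx`, the set
`𝒬` is full-dimensional if and only if `𝒫 = {x : Wx ≤ w}` is full-dimensional and
there exists `x ∈ 𝒫` with `q(x) < η`. -/
theorem cqs_full_dimensional_iff
    (m n : ℕ) (W : Matrix (Fin m) (Fin n) ℚ) (w : Fin m → ℚ)
    (H : Matrix (Fin n) (Fin n) ℚ) (h : Fin n → ℚ) (η : ℚ)
    (hsym : H.IsSymm)
    (hpsd : ∀ x : Fin n → ℝ, 0 ≤ x ⬝ᵥ ((H.map ((↑) : ℚ → ℝ)) *ᵥ x))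
    (hnz : ¬(H = 0 ∧ h = 0))
    (q : (Fin n → ℝ) → ℝ)
    (hq : q = fun x => x ⬝ᵥ ((H.map ((↑) : ℚ → ℝ)) *ᵥ x) + (fun i => (h i : ℝ)) ⬝ᵥ x)
    (P : Set (Fin n → ℝ))
    (hP : P = {x | (W.map ((↑) : ℚ → ℝ)) *ᵥ x ≤ fun i => (w i : ℝ)})
    (Q : Set (Fin n → ℝ)) (hQ : Q = {x ∈ P | q x ≤ (η : ℝ)}) :
    (interior Q).Nonempty ↔ (interior P).Nonempty ∧ ∃ x ∈ P, q x < (η : ℝ) := by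
  subst hP hQ
  have hqc : Continuous q := by rw [hq]; fun_prop
  constructor
  · intro hQi
    refine ⟨hQi.mono (interior_mono fun x hx => hx.1), ?_⟩
    by_contra! hge
    apply hnz
    obtain ⟨hH, hh⟩ := quadratic_eq_zero_of_eqOn_open (A := H.map ((↑) : ℚ → ℝ))
      (h := fun i => (h i : ℝ)) (c := (η : ℝ)) (hsym.map _) isOpen_interior hQi (by
        intro x hx
        obtain ⟨hxP, hxq⟩ := interior_subset hx
        have := le_antisymm hxq (hge x hxP)
        rwa [hq] at this)
    constructor
    · ext i j
      simpa using congrFun (congrFun hH i) j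
    · ext i
      simpa using congrFun hh i
  · rintro ⟨hPi, x, hxP, hxq⟩
    have hconv : Convex ℝ {x | (W.map ((↑) : ℚ → ℝ)) *ᵥ x ≤ fun i => (w i : ℝ)} :=
      (convex_Iic (𝕜 := ℝ) fun i => (w i : ℝ)).linear_preimage
        (W.map ((↑) : ℚ → ℝ)).mulVecLin
    obtain ⟨y, hy, hyq⟩ := hconv.exists_mem_interior_lt hPi hqc hxP hxq
    have hsub : interior {x | (W.map ((↑) : ℚ → ℝ)) *ᵥ x ≤ fun i => (w i : ℝ)} ∩ {x | q x < η} ⊆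
        {x ∈ {x | (W.map ((↑) : ℚ → ℝ)) *ᵥ x ≤ fun i => (w i : ℝ)} | q x ≤ (η : ℝ)} :=
      fun z hz => ⟨interior_subset hz.1, le_of_lt hz.2⟩
    exact ⟨y, interior_maximal hsub
      (isOpen_interior.inter (isOpen_lt hqc continuous_const)) ⟨hy, hyq⟩⟩
end
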